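/- Let (V, V₊, v) and (W, W₊, w) be complete order unit spaces with open cones C := V₊° and D := W₊°, and suppose there exists a gauge-reversing bijection Φ: C → D. Then the cone C_usc is strongly atomic: every g ∈ C_usc is the least upper bound in C_usc of the set of extremal vectors of C_usc dominated by g. -/

import Mathlib

open scoped Topology

section Defs

/-- `(V, P, v)` is an order unit space: `P` is a proper cone, the induced order is
archimedean, `v` is an order unit, and the norm of `V` is the order unit norm. -/
structure IsOrderUnitSpace (V : Type*) [NormedAddCommGroup V] [NormedSpace ℝ V]
    (P : Set V) (v : V) : Prop where
  add_mem : ∀ x ∈ P, ∀ y ∈ P, x + y ∈ P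
  smul_mem : ∀ r : ℝ, 0 ≤ r → ∀ x ∈ P, r • x ∈ P
  proper : ∀ x : V, x ∈ P → -x ∈ P → x = 0
  archimedean : ∀ x b : V, (∀ r : ℝ, 0 ≤ r → b - r • x ∈ P) → -x ∈ P
  unit_mem : v ∈ P
  unit_order : ∀ x : V, ∃ r : ℝ, 0 < r ∧ r • v - x ∈ P
  norm_eq : ∀ x : V, ‖x‖ = sInf {r : ℝ | 0 ≤ r ∧ x + r • v ∈ P ∧ r • v - x ∈ P}

variable {V : Type*} [NormedAddCommGroup V] [NormedSpace ℝ V]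
variable {W : Type*} [NormedAddCommGroup W] [NormedSpace ℝ W]

/-- The open cone (norm interior of the cone `P`) of an order unit space. -/
def openCone (P : Set V) (v : V) : Set V := {x | ∃ ε : ℝ, 0 < ε ∧ x - ε • v ∈ P}

/-- The order unit norm `‖x‖_u` determined by an order unit `u`. -/
noncomputable def ounorm (P : Set V) (u x : V) : ℝ :=
  sInf {r : ℝ | 0 ≤ r ∧ x + r • u ∈ P ∧ r • u - x ∈ P}

/-- Thompson's metric `d_T(x,y) = log inf {r ≥ 1 : r⁻¹ y ≤ x ≤ r y}`. -/
noncomputable def thompsonDist (P : Set V) (x y : V) : ℝ :=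
  Real.log (sInf {r : ℝ | 1 ≤ r ∧ x - r⁻¹ • y ∈ P ∧ r • y - x ∈ P})

/-- `Φ` is a gauge-reversing bijection from the open cone of `(V, P, v)` onto the
open cone of `(W, Q, w)`: a bijection, homogeneous of degree `-1`,
and an order-anti-isomorphism. -/
def GaugeReversing (P : Set V) (v : V) (Q : Set W) (w : W) (Φ : V → W) : Prop :=
  Set.BijOn Φ (openCone P v) (openCone Q w) ∧
  (∀ x ∈ openCone P v, ∀ r : ℝ, 0 < r → Φ (r • x) = r⁻¹ • Φ x) ∧
  (∀ x ∈ openCone P v, ∀ y ∈ openCone P v, (y - x ∈ P ↔ Φ x - Φ y ∈ Q))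

/-- `Φ` is a gauge-preserving bijection from the open cone of `(V, P, v)` onto the
open cone of `(W, Q, w)`: a bijection, homogeneous of degree `1`,
and an order-isomorphism. -/
def GaugePreserving (P : Set V) (v : V) (Q : Set W) (w : W) (Φ : V → W) : Prop :=
  Set.BijOn Φ (openCone P v) (openCone Q w) ∧
  (∀ x ∈ openCone P v, ∀ r : ℝ, 0 < r → Φ (r • x) = r • Φ x) ∧
  (∀ x ∈ openCone P v, ∀ y ∈ openCone P v, (y - x ∈ P ↔ Φ y - Φ x ∈ Q))

/-- `mul` is a JB-algebra structure on the order unit space `(V, P, v)` with unit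
element `v` and cone of squares `P`. -/
def IsJBAlgebraStructure (P : Set V) (v : V) (mul : V →ₗ[ℝ] V →ₗ[ℝ] V) : Prop :=
  (∀ x y : V, mul x y = mul y x) ∧
  (∀ x : V, mul v x = x) ∧
  (∀ x y : V, mul x (mul y (mul x x)) = mul (mul x y) (mul x x)) ∧
  (∀ x y : V, ‖mul x y‖ ≤ ‖x‖ * ‖y‖) ∧
  (∀ x : V, ‖mul x x‖ = ‖x‖ ^ 2) ∧
  (∀ x y : V, ‖mul x x‖ ≤ ‖mul x x + mul y y‖) ∧
  P = {y : V | ∃ x : V, mul x x = y}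

/-- `S` is a `d_T`-symmetry of the open cone of `(V, P, v)` at the point `p`:
an involutive `d_T`-isometry of the open cone having `p` as an isolated fixed point. -/
def IsDTSymmetry (P : Set V) (v : V) (S : V → V) (p : V) : Prop :=
  (∀ x ∈ openCone P v, S x ∈ openCone P v) ∧
  (∀ x ∈ openCone P v, S (S x) = x) ∧
  (∀ x ∈ openCone P v, ∀ y ∈ openCone P v,
    thompsonDist P (S x) (S y) = thompsonDist P x y) ∧
  p ∈ openCone P v ∧ S p = p ∧
  (∃ ε : ℝ, 0 < ε ∧ ∀ x ∈ openCone P v, S x = x → thompsonDist P p x < ε → x = p)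

/-- A complete order unit space `(W, Q, w)` together with a gauge-reversing bijection
from the open cone of `(V, P, v)` onto the open cone of `(W, Q, w)`. -/
structure GaugeReversingTarget (V : Type*) [NormedAddCommGroup V] [NormedSpace ℝ V]
    (P : Set V) (v : V) where
  W : Type
  [instGroup : NormedAddCommGroup W]
  [instSpace : NormedSpace ℝ W]
  [instComplete : CompleteSpace W]
  Q : Set W
  w : W
  ous : IsOrderUnitSpace W Q w
  Φ : V → W
  grev : GaugeReversing P v Q w Φ

/-- The state space of the order unit space `(V, P, v)`, as a subset of the
weak-* dual of `V`. -/
def stateSpace (P : Set V) (v : V) : Set (WeakDual ℝ V) :=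
  {ρ | (∀ x ∈ P, 0 ≤ ρ x) ∧ ρ v = 1}

/-- A real-valued function on the dual is affine on `K`. -/
def AffineOnK (K : Set (WeakDual ℝ V)) (g : WeakDual ℝ V → ℝ) : Prop :=
  ∀ ρ ∈ K, ∀ σ ∈ K, ∀ t : ℝ, 0 ≤ t → t ≤ 1 →
    g ((1 - t) • ρ + t • σ) = (1 - t) * g ρ + t * g σ

/-- An extended-real-valued function on the dual is affine on `K`. -/
def AffineOnKE (K : Set (WeakDual ℝ V)) (g : WeakDual ℝ V → EReal) : Prop :=
  ∀ ρ ∈ K, ∀ σ ∈ K, ∀ t : ℝ, 0 ≤ t → t ≤ 1 →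
    g ((1 - t) • ρ + t • σ) = ((1 - t : ℝ) : EReal) * g ρ + ((t : ℝ) : EReal) * g σ

/-- Membership in the extended cone `C_usc` of nonnegative affine upper semicontinuous
functions on the state space `K`. -/
def memCusc (K : Set (WeakDual ℝ V)) (g : WeakDual ℝ V → ℝ) : Prop :=
  (∀ ρ ∈ K, 0 ≤ g ρ) ∧ AffineOnK K g ∧ UpperSemicontinuousOn g K

/-- `p` is an extremal vector of the cone `C_usc` over the state space `K`. -/
def IsExtremalCusc (K : Set (WeakDual ℝ V)) (p : WeakDual ℝ V → ℝ) : Prop :=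
  memCusc K p ∧ (∃ ρ ∈ K, p ρ ≠ 0) ∧
  ∀ x, memCusc K x → (∀ ρ ∈ K, x ρ ≤ p ρ) →
    ∃ t : ℝ, 0 ≤ t ∧ t ≤ 1 ∧ ∀ ρ ∈ K, x ρ = t * p ρ

/-- The cone `C_usc` over the state space `K` is strongly atomic: each of its
members is the least upper bound of the extremal vectors it dominates. -/
def StronglyAtomicCusc (K : Set (WeakDual ℝ V)) : Prop :=
  ∀ g, memCusc K g →
    (∀ p, IsExtremalCusc K p → (∀ ρ ∈ K, p ρ ≤ g ρ) → ∀ ρ ∈ K, p ρ ≤ g ρ) ∧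
    (∀ h, memCusc K h →
      (∀ p, IsExtremalCusc K p → (∀ ρ ∈ K, p ρ ≤ g ρ) → ∀ ρ ∈ K, p ρ ≤ h ρ) →
      ∀ ρ ∈ K, g ρ ≤ h ρ)

end Defs

theorem isCompact_convexJoin {E : Type*} [AddCommGroup E] [Module ℝ E] [TopologicalSpace E]
    [ContinuousAdd E] [ContinuousSMul ℝ E] {s t : Set E} (hs : IsCompact s) (ht : IsCompact t) :
    IsCompact (convexJoin ℝ s t) := by
  have hc : Continuous fun p : E × E × ℝ => (1 - p.2.2) • p.1 + p.2.2 • p.2.1 := by fun_prop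
  convert (hs.prod (ht.prod (isCompact_Icc (a := (0 : ℝ)) (b := 1)))).image hc using 1
  ext x
  simp only [mem_convexJoin, segment_eq_image, Set.mem_image, Set.mem_prod, Prod.exists]
  constructor
  · rintro ⟨a, ha, b, hb, θ, hθ, rfl⟩
    exact ⟨a, b, θ, ⟨ha, hb, hθ⟩, rfl⟩
  · rintro ⟨a, b, θ, ⟨ha, hb, hθ⟩, rfl⟩
    exact ⟨a, ha, b, hb, θ, hθ, rfl⟩

/-- Intersecting a compact set with a downward directed family of closed half-spaces. -/
theorem exists_mem_forall_of_directed {X ι : Type*} [TopologicalSpace X] [T2Space X]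
    {K : Set X} (hK : IsCompact K) {I : Set ι} (hI : I.Nonempty) (f : ι → X → ℝ)
    (hf : ∀ i ∈ I, Continuous (f i)) (c : ℝ)
    (hdir : ∀ i ∈ I, ∀ j ∈ I, ∃ k ∈ I, ∀ x ∈ K, f i x ≤ f k x ∧ f j x ≤ f k x)
    (hne : ∀ i ∈ I, ∃ x ∈ K, f i x ≤ c) : ∃ x ∈ K, ∀ i ∈ I, f i x ≤ c := by
  have : Nonempty I := hI.to_subtype
  have hcl : ∀ i : I, IsClosed (K ∩ {x | f i x ≤ c}) := fun i =>
    hK.isClosed.inter (isClosed_le (hf i i.2) continuous_const)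
  obtain ⟨x, hx⟩ := IsCompact.nonempty_iInter_of_directed_nonempty_isCompact_isClosed
    (fun i : I => K ∩ {x | f i x ≤ c})
    (fun i j => by
      obtain ⟨k, hk, h⟩ := hdir i i.2 j j.2
      exact ⟨⟨k, hk⟩, fun x hx => ⟨hx.1, (h x hx.1).1.trans hx.2⟩,
        fun x hx => ⟨hx.1, (h x hx.1).2.trans hx.2⟩⟩)
    (fun i => hne i i.2)
    (fun i => hK.of_isClosed_subset (hcl i) Set.inter_subset_left) hcl
  rw [Set.mem_iInter] at hx
  exact ⟨x, (hx this.some).1, fun i hi => (hx ⟨i, hi⟩).2⟩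

/-- The weak-* continuous functionals that are nonnegative on `P`. -/
def dualCone {V : Type*} [NormedAddCommGroup V] [NormedSpace ℝ V] (P : Set V) :
    Set (WeakDual ℝ V) := {τ | ∀ x ∈ P, 0 ≤ τ x}

section Separation

variable {V : Type*} [NormedAddCommGroup V] [NormedSpace ℝ V]

theorem WeakDual.exists_eq_eval (f : StrongDual ℝ (WeakDual ℝ V)) :
    ∃ a : V, ∀ ρ : WeakDual ℝ V, f ρ = ρ a := by
  obtain ⟨a, ha⟩ := LinearMap.dualEmbedding_surjective (topDualPairing ℝ V) f
  exact ⟨a, fun ρ => by rw [← ha]; rfl⟩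

instance WeakDual.locallyConvexSpace : LocallyConvexSpace ℝ (WeakDual ℝ V) :=
  WeakBilin.locallyConvexSpace (B := topDualPairing ℝ V)

/-- An affine upper semicontinuous function lying strictly below the concave hull of two
continuous affine functions can be separated from both of them by a continuous affine function. -/
theorem exists_affine_between {v : V} {K L : Set (WeakDual ℝ V)} (hKc : IsCompact K)
    (hKx : Convex ℝ K) (hL : IsClosed L) (hLx : Convex ℝ L) (hKv : ∀ ρ ∈ K, ρ v = 1)
    (hLv : ∀ ρ ∈ L, ρ v = 1) (hne : (K ∩ L).Nonempty) {g : WeakDual ℝ V → ℝ}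
    (hg : AffineOnK L g) (hgu : UpperSemicontinuousOn g L) {x₁ x₂ : V}
    (hx : ∀ ρ₁ ∈ K, ∀ ρ₂ ∈ K, ∀ a b : ℝ, 0 ≤ a → 0 ≤ b → a + b = 1 → a • ρ₁ + b • ρ₂ ∈ L →
      g (a • ρ₁ + b • ρ₂) < a * ρ₁ x₁ + b * ρ₂ x₂) :
    ∃ x₃ : V, (∀ ρ ∈ L, g ρ < ρ x₃) ∧ ∀ ρ ∈ K, ρ x₃ < ρ x₁ ∧ ρ x₃ < ρ x₂ := by
  have hgraph : ∀ x : V, Convex ℝ ((fun ρ : WeakDual ℝ V => (ρ, ρ x)) '' K) ∧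
      IsCompact ((fun ρ : WeakDual ℝ V => (ρ, ρ x)) '' K) := fun x =>
    ⟨hKx.is_linear_image ⟨fun _ _ => rfl, fun _ _ => rfl⟩,
      hKc.image (continuous_id.prodMk (WeakDual.eval_continuous x))⟩
  have hFc := (upperSemicontinuousOn_iff_isClosed_hypograph hL).1 hgu
  have hFx : Convex ℝ {p : WeakDual ℝ V × ℝ | p.1 ∈ L ∧ p.2 ≤ g p.1} := by
    rintro ⟨ρ, s⟩ ⟨hρ, hs⟩ ⟨σ, t⟩ ⟨hσ, ht⟩ a b ha hb hab
    refine ⟨hLx hρ hσ ha hb hab, ?_⟩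
    obtain rfl : a = 1 - b := by linarith
    have := hg ρ hρ σ hσ b hb (by linarith)
    simp only [Prod.smul_mk, Prod.mk_add_mk, smul_eq_mul] at *
    rw [this]
    gcongr
  have hdisj : Disjoint (convexJoin ℝ ((fun ρ : WeakDual ℝ V => (ρ, ρ x₁)) '' K)
      ((fun ρ : WeakDual ℝ V => (ρ, ρ x₂)) '' K))
      {p : WeakDual ℝ V × ℝ | p.1 ∈ L ∧ p.2 ≤ g p.1} := by
    rw [Set.disjoint_left]
    rintro p hp ⟨hpL, hpg⟩
    rw [mem_convexJoin] at hp
    obtain ⟨_, ⟨ρ₁, h₁, rfl⟩, _, ⟨ρ₂, h₂, rfl⟩, a, b, ha, hb, hab, rfl⟩ := hp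
    exact absurd hpg (not_le.2 (hx ρ₁ h₁ ρ₂ h₂ a b ha hb hab hpL))
  obtain ⟨f, u, w, hfG, huw, hfF⟩ := geometric_hahn_banach_compact_closed
    ((hgraph x₁).1.convexJoin (hgraph x₂).1)
    (isCompact_convexJoin (hgraph x₁).2 (hgraph x₂).2) hFx hFc hdisj
  obtain ⟨a, ha⟩ := WeakDual.exists_eq_eval (f.comp (ContinuousLinearMap.inl ℝ _ ℝ))
  set c : ℝ := f (0, 1)
  have hf : ∀ (ρ : WeakDual ℝ V) (t : ℝ), f (ρ, t) = ρ a + t * c := by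
    intro ρ t
    have h1 : ((ρ, t) : WeakDual ℝ V × ℝ) = (ρ, 0) + t • (0, 1) := by simp
    rw [h1, map_add, map_smul, ← ha ρ]
    rfl
  have hG : ∀ ρ ∈ K, ρ a + ρ x₁ * c < u ∧ ρ a + ρ x₂ * c < u := by
    intro ρ hρ
    rw [← hf, ← hf]
    exact ⟨hfG _ (mem_convexJoin.2 ⟨_, ⟨ρ, hρ, rfl⟩, _, ⟨ρ, hρ, rfl⟩, left_mem_segment _ _ _⟩),
      hfG _ (mem_convexJoin.2 ⟨_, ⟨ρ, hρ, rfl⟩, _, ⟨ρ, hρ, rfl⟩, right_mem_segment _ _ _⟩)⟩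
  have hF : ∀ ρ ∈ L, w < ρ a + g ρ * c := by
    intro ρ hρ
    rw [← hf]
    exact hfF _ ⟨hρ, le_rfl⟩
  have hc0 : c < 0 := by
    obtain ⟨ρ, hρK, hρL⟩ := hne
    have h1 := (hG ρ hρK).1
    have h2 := hF ρ hρL
    have h3 := hx ρ hρK ρ hρK 1 0 zero_le_one le_rfl (by norm_num) (by simpa using hρL)
    simp only [one_smul, zero_smul, add_zero, one_mul, zero_mul] at h3
    nlinarith
  refine ⟨c⁻¹ • (w • v - a), fun ρ hρ => ?_, fun ρ hρ => ?_⟩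
  · have := hF ρ hρ
    rw [map_smul, map_sub, map_smul, hLv ρ hρ, smul_eq_mul, smul_eq_mul, ← div_eq_inv_mul,
      lt_div_iff_of_neg hc0]
    linarith
  · have := hG ρ hρ
    rw [map_smul, map_sub, map_smul, hKv ρ hρ, smul_eq_mul, smul_eq_mul, ← div_eq_inv_mul,
      div_lt_iff_of_neg hc0, div_lt_iff_of_neg hc0]
    constructor <;> linarith

end Separation

namespace IsOrderUnitSpace

variable {V : Type*} [NormedAddCommGroup V] [NormedSpace ℝ V] {P : Set V} {v : V}

theorem zero_mem (h : IsOrderUnitSpace V P v) : (0 : V) ∈ P := by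
  simpa using h.smul_mem 0 le_rfl v h.unit_mem

theorem bounds_of_norm_lt (h : IsOrderUnitSpace V P v) {x : V} {r : ℝ} (hx : ‖x‖ < r) :
    x + r • v ∈ P ∧ r • v - x ∈ P := by
  rw [h.norm_eq] at hx
  have hne : {r : ℝ | 0 ≤ r ∧ x + r • v ∈ P ∧ r • v - x ∈ P}.Nonempty := by
    obtain ⟨a, ha, ha'⟩ := h.unit_order x
    obtain ⟨b, hb, hb'⟩ := h.unit_order (-x)
    refine ⟨a + b, by positivity, ?_, ?_⟩
    · convert h.add_mem _ hb' _ (h.smul_mem a ha.le v h.unit_mem) using 1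
      module
    · convert h.add_mem _ ha' _ (h.smul_mem b hb.le v h.unit_mem) using 1
      module
  obtain ⟨s, ⟨-, hs1, hs2⟩, hsr⟩ := exists_lt_of_csInf_lt hne hx
  have h3 := h.smul_mem (r - s) (by linarith) v h.unit_mem
  constructor
  · convert h.add_mem _ hs1 _ h3 using 1
    module
  · convert h.add_mem _ hs2 _ h3 using 1
    module

theorem isClosed (h : IsOrderUnitSpace V P v) : IsClosed P := by
  refine isClosed_of_closure_subset fun x hx => ?_
  have key : ∀ ε : ℝ, 0 < ε → x + ε • v ∈ P := by
    intro ε hε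
    obtain ⟨q, hq, hxq⟩ := Metric.mem_closure_iff.1 hx ε hε
    rw [dist_eq_norm] at hxq
    convert h.add_mem _ (h.bounds_of_norm_lt hxq).1 _ hq using 1
    module
  have := h.archimedean (-x) v fun r hr => by
    rcases hr.eq_or_lt with rfl | hr
    · simpa using h.unit_mem
    · convert h.smul_mem r hr.le _ (key r⁻¹ (inv_pos.2 hr)) using 1
      rw [smul_add, smul_inv_smul₀ hr.ne']
      module
  simpa using this

theorem convex (h : IsOrderUnitSpace V P v) : Convex ℝ P :=
  fun _ hx _ hy _ _ ha hb _ => h.add_mem _ (h.smul_mem _ ha _ hx) _ (h.smul_mem _ hb _ hy)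

theorem abs_apply_le (h : IsOrderUnitSpace V P v) {τ : WeakDual ℝ V} (hτ : τ ∈ dualCone P)
    {x : V} {r : ℝ} (hx : ‖x‖ < r) : |τ x| ≤ r * τ v := by
  obtain ⟨h1, h2⟩ := h.bounds_of_norm_lt hx
  have h3 := hτ _ h1
  have h4 := hτ _ h2
  rw [map_add, map_smul, smul_eq_mul] at h3
  rw [map_sub, map_smul, smul_eq_mul] at h4
  exact abs_le.2 ⟨by linarith, by linarith⟩

theorem eq_zero_of_apply_unit (h : IsOrderUnitSpace V P v) {τ : WeakDual ℝ V}
    (hτ : τ ∈ dualCone P) (h0 : τ v = 0) : τ = 0 := by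
  refine DFunLike.ext _ _ fun x => ?_
  have := h.abs_apply_le hτ (lt_add_one ‖x‖)
  rw [h0, mul_zero] at this
  exact abs_nonpos_iff.1 this

theorem apply_unit_pos (h : IsOrderUnitSpace V P v) {τ : WeakDual ℝ V}
    (hτ : τ ∈ dualCone P) (h0 : τ ≠ 0) : 0 < τ v :=
  (hτ v h.unit_mem).lt_of_ne fun he => h0 (h.eq_zero_of_apply_unit hτ he.symm)

theorem isClosed_dualCone : IsClosed (dualCone P) := by
  simp only [dualCone, Set.ofPred_forall]
  exact isClosed_iInter fun x => isClosed_iInter fun _ =>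
    isClosed_le continuous_const (WeakDual.eval_continuous x)

theorem convex_dualCone : Convex ℝ (dualCone P) := by
  intro σ hσ τ hτ a b ha hb _ x hx
  exact add_nonneg (mul_nonneg ha (hσ x hx)) (mul_nonneg hb (hτ x hx))

theorem isCompact_dualCone_inter (h : IsOrderUnitSpace V P v) (M : ℝ) :
    IsCompact {τ : WeakDual ℝ V | τ ∈ dualCone P ∧ τ v ≤ M} := by
  have hM : 0 < |M| + 1 := by positivity
  refine (WeakDual.isCompact_polar (𝕜 := ℝ) (Metric.ball_mem_nhds (0 : V)
    (inv_pos.2 hM))).of_isClosed_subset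
    (isClosed_dualCone.inter (isClosed_le (WeakDual.eval_continuous v) continuous_const)) ?_
  rintro τ ⟨hτ, hτM⟩
  rw [WeakDual.polar_def]
  intro x hx
  rw [mem_ball_zero_iff] at hx
  refine (h.abs_apply_le hτ hx).trans ?_
  rw [← div_eq_inv_mul, div_le_one hM]
  linarith [le_abs_self M]

theorem isClosed_stateSpace : IsClosed (stateSpace P v) :=
  isClosed_dualCone.inter (isClosed_eq (WeakDual.eval_continuous v) continuous_const)

theorem isCompact_stateSpace (h : IsOrderUnitSpace V P v) : IsCompact (stateSpace P v) :=
  (h.isCompact_dualCone_inter 1).of_isClosed_subset isClosed_stateSpace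
    fun _ hρ => ⟨hρ.1, hρ.2.le⟩

theorem convex_stateSpace : Convex ℝ (stateSpace P v) := by
  intro σ hσ τ hτ a b ha hb hab
  refine ⟨convex_dualCone hσ.1 hτ.1 ha hb hab, ?_⟩
  change a * σ v + b * τ v = 1
  rw [hσ.2, hτ.2]
  linarith

theorem mem_of_forall_dualCone (h : IsOrderUnitSpace V P v) {y : V}
    (hy : ∀ τ ∈ dualCone P, 0 ≤ τ y) : y ∈ P := by
  by_contra hyP
  obtain ⟨f, u, hfy, hfP⟩ := geometric_hahn_banach_point_closed h.convex h.isClosed hyP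
  have hu : u < 0 := by simpa using hfP 0 h.zero_mem
  have hpos : StrongDual.toWeakDual f ∈ dualCone P := by
    intro b hb
    change 0 ≤ f b
    by_contra! hlt
    have := hfP _ (h.smul_mem (u / f b) (div_nonneg_of_nonpos hu.le hlt.le) b hb)
    rw [map_smul, smul_eq_mul, div_mul_cancel₀ _ hlt.ne] at this
    exact lt_irrefl _ this
  have : 0 ≤ f y := hy _ hpos
  linarith

theorem smul_mem_stateSpace {τ : WeakDual ℝ V} (hτ : τ ∈ dualCone P) (h0 : 0 < τ v) :
    (τ v)⁻¹ • τ ∈ stateSpace P v :=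
  ⟨fun x hx => mul_nonneg (inv_nonneg.2 h0.le) (hτ x hx), inv_mul_cancel₀ h0.ne'⟩

theorem mem_of_forall_stateSpace (h : IsOrderUnitSpace V P v) {y : V}
    (hy : ∀ ρ ∈ stateSpace P v, 0 ≤ ρ y) : y ∈ P := by
  refine h.mem_of_forall_dualCone fun τ hτ => ?_
  rcases eq_or_ne τ 0 with rfl | h0
  · rfl
  · have hv := h.apply_unit_pos hτ h0
    have : 0 ≤ (τ v)⁻¹ * τ y := hy _ (smul_mem_stateSpace hτ hv)
    exact nonneg_of_mul_nonneg_right this (inv_pos.2 hv)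

theorem unit_mem_openCone (h : IsOrderUnitSpace V P v) : v ∈ openCone P v :=
  ⟨1, one_pos, by simpa using h.zero_mem⟩

theorem smul_mem_openCone (h : IsOrderUnitSpace V P v) {x : V} (hx : x ∈ openCone P v)
    {r : ℝ} (hr : 0 < r) : r • x ∈ openCone P v := by
  obtain ⟨ε, hε, hx⟩ := hx
  refine ⟨r * ε, by positivity, ?_⟩
  convert h.smul_mem r hr.le _ hx using 1
  module

theorem add_mem_openCone (h : IsOrderUnitSpace V P v) {x y : V} (hx : x ∈ openCone P v)
    (hy : y ∈ P) : y + x ∈ openCone P v := by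
  obtain ⟨ε, hε, hx⟩ := hx
  refine ⟨ε, hε, ?_⟩
  convert h.add_mem _ hy _ hx using 1
  module

theorem apply_pos (h : IsOrderUnitSpace V P v) {x : V} (hx : x ∈ openCone P v)
    {τ : WeakDual ℝ V} (hτ : τ ∈ dualCone P) (h0 : τ ≠ 0) : 0 < τ x := by
  obtain ⟨ε, hε, hx⟩ := hx
  have h1 := hτ _ hx
  rw [map_sub, map_smul, smul_eq_mul] at h1
  have := mul_pos hε (h.apply_unit_pos hτ h0)
  linarith

theorem ne_zero_of_mem_stateSpace {ρ : WeakDual ℝ V} (hρ : ρ ∈ stateSpace P v) : ρ ≠ 0 := by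
  rintro rfl
  exact zero_ne_one hρ.2

theorem mem_openCone_of_forall_pos (h : IsOrderUnitSpace V P v) {x : V}
    (hx : ∀ ρ ∈ stateSpace P v, 0 < ρ x) : x ∈ openCone P v := by
  rcases (stateSpace P v).eq_empty_or_nonempty with he | hne
  · exact ⟨1, one_pos, h.mem_of_forall_stateSpace (by simp [he])⟩
  · obtain ⟨ρ₀, hρ₀, hmin⟩ := h.isCompact_stateSpace.exists_isMinOn hne
      (WeakDual.eval_continuous x).continuousOn
    refine ⟨ρ₀ x, hx ρ₀ hρ₀, h.mem_of_forall_stateSpace fun ρ hρ => ?_⟩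
    rw [map_sub, map_smul, smul_eq_mul, hρ.2, mul_one, sub_nonneg]
    exact hmin hρ

theorem isCompact_dualCone_inter_of_mem_openCone (h : IsOrderUnitSpace V P v) {x : V}
    (hx : x ∈ openCone P v) (M : ℝ) : IsCompact {τ : WeakDual ℝ V | τ ∈ dualCone P ∧ τ x ≤ M} := by
  obtain ⟨ε, hε, hx⟩ := hx
  refine (h.isCompact_dualCone_inter (M / ε)).of_isClosed_subset
    (isClosed_dualCone.inter (isClosed_le (WeakDual.eval_continuous x) continuous_const)) ?_
  rintro τ ⟨hτ, hτM⟩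
  have h1 := hτ _ hx
  rw [map_sub, map_smul, smul_eq_mul] at h1
  exact ⟨hτ, by rw [le_div_iff₀ hε]; linarith⟩

end IsOrderUnitSpace

/-- The elements of the open cone lying strictly above `g` on the state space. -/
def cuscMajorants {V : Type*} [NormedAddCommGroup V] [NormedSpace ℝ V] (P : Set V) (v : V)
    (g : WeakDual ℝ V → ℝ) : Set V :=
  {x | x ∈ openCone P v ∧ ∀ ρ ∈ stateSpace P v, g ρ < ρ x}

/-- `σ` spans an extreme ray of the dual cone of `Q`. -/
def IsExtremeRay {W : Type*} [NormedAddCommGroup W] [NormedSpace ℝ W] (Q : Set W)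
    (σ : WeakDual ℝ W) : Prop :=
  σ ∈ dualCone Q ∧ σ ≠ 0 ∧
    ∀ τ ∈ dualCone Q, σ - τ ∈ dualCone Q → ∃ s : ℝ, 0 ≤ s ∧ s ≤ 1 ∧ τ = s • σ

namespace IsOrderUnitSpace

variable {V : Type*} [NormedAddCommGroup V] [NormedSpace ℝ V] {P : Set V} {v : V}

theorem mem_cuscMajorants (h : IsOrderUnitSpace V P v) {g : WeakDual ℝ V → ℝ}
    (hg : memCusc (stateSpace P v) g) {x : V} (hx : ∀ ρ ∈ stateSpace P v, g ρ < ρ x) :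
    x ∈ cuscMajorants P v g :=
  ⟨h.mem_openCone_of_forall_pos fun ρ hρ => (hg.1 ρ hρ).trans_lt (hx ρ hρ), hx⟩

theorem cuscMajorants_nonempty (h : IsOrderUnitSpace V P v) {g : WeakDual ℝ V → ℝ}
    (hg : memCusc (stateSpace P v) g) : (cuscMajorants P v g).Nonempty := by
  obtain ⟨M, hM⟩ := hg.2.2.bddAbove_of_isCompact h.isCompact_stateSpace
  refine ⟨(M + 1) • v, h.mem_cuscMajorants hg fun ρ hρ => ?_⟩
  rw [map_smul, hρ.2, smul_eq_mul, mul_one]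
  linarith [hM ⟨ρ, hρ, rfl⟩]

theorem exists_cuscMajorant_lt (h : IsOrderUnitSpace V P v) {g : WeakDual ℝ V → ℝ}
    (hg : memCusc (stateSpace P v) g) {ρ : WeakDual ℝ V} (hρ : ρ ∈ stateSpace P v) {r : ℝ}
    (hr : g ρ < r) : ∃ x ∈ cuscMajorants P v g, ρ x < r := by
  have hρr : ρ (r • v) = r := by rw [map_smul, hρ.2, smul_eq_mul, mul_one]
  obtain ⟨x, hx, hx'⟩ := exists_affine_between (K := {ρ}) (x₁ := r • v) (x₂ := r • v)
    isCompact_singleton (convex_singleton ρ) isClosed_stateSpace convex_stateSpace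
    (by rintro _ rfl; exact hρ.2) (fun ρ hρ => hρ.2) ⟨ρ, rfl, hρ⟩ hg.2.1 hg.2.2 (by
      rintro _ rfl _ rfl a b ha hb hab -
      rwa [← add_smul, hab, one_smul, ← add_mul, hab, one_mul, hρr])
  exact ⟨x, h.mem_cuscMajorants hg hx, by simpa [hρ.2] using (hx' ρ rfl).1⟩

theorem cuscMajorants_directed (h : IsOrderUnitSpace V P v) {g : WeakDual ℝ V → ℝ}
    (hg : memCusc (stateSpace P v) g) (hne : (stateSpace P v).Nonempty) {x₁ x₂ : V}
    (h₁ : x₁ ∈ cuscMajorants P v g) (h₂ : x₂ ∈ cuscMajorants P v g) :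
    ∃ x₃ ∈ cuscMajorants P v g, x₁ - x₃ ∈ P ∧ x₂ - x₃ ∈ P := by
  obtain ⟨x, hx, hx'⟩ := exists_affine_between (x₁ := x₁) (x₂ := x₂)
    h.isCompact_stateSpace convex_stateSpace isClosed_stateSpace convex_stateSpace
    (fun ρ hρ => hρ.2) (fun ρ hρ => hρ.2) (by simpa using hne) hg.2.1 hg.2.2 (by
      intro ρ₁ hρ₁ ρ₂ hρ₂ a b ha hb hab _
      obtain rfl : a = 1 - b := by linarith
      rw [hg.2.1 ρ₁ hρ₁ ρ₂ hρ₂ b hb (by linarith)]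
      have e₁ := h₁.2 ρ₁ hρ₁
      have e₂ := h₂.2 ρ₂ hρ₂
      rcases hb.eq_or_lt with rfl | hb
      · simpa using e₁
      · exact add_lt_add_of_le_of_lt (by gcongr) (by gcongr))
  exact ⟨x, h.mem_cuscMajorants hg hx,
    h.mem_of_forall_stateSpace fun ρ hρ => by rw [map_sub]; linarith [(hx' ρ hρ).1],
    h.mem_of_forall_stateSpace fun ρ hρ => by rw [map_sub]; linarith [(hx' ρ hρ).2]⟩

/-- Sublevel sets of a functional spanning an extreme ray are upward directed. -/
theorem exists_upper_of_isExtremeRay (h : IsOrderUnitSpace V P v) {σ : WeakDual ℝ V}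
    (hσ : IsExtremeRay P σ) {y₁ y₂ : V} (h₁ : σ y₁ < 1) (h₂ : σ y₂ < 1) :
    ∃ y₃, y₃ - y₁ ∈ P ∧ y₃ - y₂ ∈ P ∧ σ y₃ < 1 := by
  obtain ⟨hσP, hσ0, hext⟩ := hσ
  have hc := h.apply_unit_pos hσP hσ0
  have hstate := smul_mem_stateSpace hσP hc
  obtain ⟨x, hx, hx'⟩ := exists_affine_between (L := {(σ v)⁻¹ • σ}) (g := fun _ => -(σ v)⁻¹)
    (x₁ := -y₁) (x₂ := -y₂)
    h.isCompact_stateSpace convex_stateSpace isClosed_singleton (convex_singleton _)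
    (fun ρ hρ => hρ.2) (by rintro _ rfl; exact hstate.2) ⟨_, hstate, rfl⟩
    (fun _ _ _ _ t _ _ => by ring) upperSemicontinuousOn_const (by
      intro ρ₁ hρ₁ ρ₂ hρ₂ a b ha hb hab hL
      have hL : a • ρ₁ + b • ρ₂ = (σ v)⁻¹ • σ := hL
      have hsum : σ = (σ v * a) • ρ₁ + (σ v * b) • ρ₂ := by
        rw [mul_smul, mul_smul, ← smul_add, hL, smul_inv_smul₀ hc.ne']
      have hmem : ∀ {ρ : WeakDual ℝ V} {t : ℝ}, ρ ∈ stateSpace P v → 0 ≤ t →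
          (σ v * t) • ρ ∈ dualCone P := fun hρ ht x hx =>
        mul_nonneg (mul_nonneg hc.le ht) (hρ.1 x hx)
      obtain ⟨s, hs0, hs1, hs⟩ := hext ((σ v * a) • ρ₁) (hmem hρ₁ ha) (by
        rw [sub_eq_of_eq_add' hsum]
        exact hmem hρ₂ hb)
      have hsa : σ v * a * ρ₁ v = s * σ v := congrArg (fun τ : WeakDual ℝ V => τ v) hs
      rw [hρ₁.2, mul_one, mul_comm, mul_left_inj' hc.ne'] at hsa
      subst hsa
      have e₁ : σ v * a * ρ₁ y₁ = a * σ y₁ := congrArg (fun τ : WeakDual ℝ V => τ y₁) hs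
      have e₂ : σ y₂ = σ v * a * ρ₁ y₂ + σ v * b * ρ₂ y₂ :=
        congrArg (fun τ : WeakDual ℝ V => τ y₂) hsum
      have e₃ : σ v * a * ρ₁ y₂ = a * σ y₂ := congrArg (fun τ : WeakDual ℝ V => τ y₂) hs
      obtain rfl : b = 1 - a := by linarith
      rw [map_neg, map_neg, neg_lt_iff_pos_add, ← mul_pos_iff_of_pos_left hc, mul_add,
        mul_inv_cancel₀ hc.ne']
      have : a * σ y₁ + (1 - a) * σ y₂ < 1 := by
        rcases ha.eq_or_lt with rfl | ha
        · simpa using h₂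
        · nlinarith
      linarith)
  refine ⟨-x, h.mem_of_forall_stateSpace fun ρ hρ => ?_,
    h.mem_of_forall_stateSpace fun ρ hρ => ?_, ?_⟩
  · have := (hx' ρ hρ).1
    rw [map_neg] at this
    rw [map_sub, map_neg]
    linarith
  · have := (hx' ρ hρ).2
    rw [map_neg] at this
    rw [map_sub, map_neg]
    linarith
  · have : -(σ v)⁻¹ < (σ v)⁻¹ * σ x := hx _ rfl
    rw [neg_lt_iff_pos_add, ← mul_pos_iff_of_pos_left hc, mul_add, mul_inv_cancel₀ hc.ne',
      mul_inv_cancel_left₀ hc.ne'] at this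
    rw [map_neg]
    linarith

end IsOrderUnitSpace

section GaugeReversing

variable {V : Type*} [NormedAddCommGroup V] [NormedSpace ℝ V]
variable {W : Type*} [NormedAddCommGroup W] [NormedSpace ℝ W]
variable {P : Set V} {v : V} {Q : Set W} {w : W} {Φ : V → W}

/-- The positive functionals bounded by `1` on the `Φ`-images of all strict majorants of `g`. -/
def polarBody (P : Set V) (v : V) (Q : Set W) (Φ : V → W) (g : WeakDual ℝ V → ℝ) :
    Set (WeakDual ℝ W) :=
  {τ | τ ∈ dualCone Q ∧ ∀ x ∈ cuscMajorants P v g, τ (Φ x) ≤ 1}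

theorem isClosed_polarBody (g : WeakDual ℝ V → ℝ) : IsClosed (polarBody P v Q Φ g) := by
  have : polarBody P v Q Φ g =
      dualCone Q ∩ ⋂ x ∈ cuscMajorants P v g, {τ : WeakDual ℝ W | τ (Φ x) ≤ 1} := by
    ext τ
    simp [polarBody]
  rw [this]
  exact IsOrderUnitSpace.isClosed_dualCone.inter <| isClosed_biInter fun x _ =>
    isClosed_le (WeakDual.eval_continuous (Φ x)) continuous_const

theorem convex_polarBody (g : WeakDual ℝ V → ℝ) : Convex ℝ (polarBody P v Q Φ g) := by
  intro σ hσ τ hτ a b ha hb hab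
  refine ⟨IsOrderUnitSpace.convex_dualCone hσ.1 hτ.1 ha hb hab, fun x hx => ?_⟩
  change a * σ (Φ x) + b * τ (Φ x) ≤ 1
  nlinarith [hσ.2 x hx, hτ.2 x hx]

theorem zero_mem_polarBody (g : WeakDual ℝ V → ℝ) : 0 ∈ polarBody P v Q Φ g :=
  ⟨fun _ _ => le_rfl, fun _ _ => zero_le_one⟩

theorem isCompact_polarBody (hV : IsOrderUnitSpace V P v) (hW : IsOrderUnitSpace W Q w)
    (hΦ : GaugeReversing P v Q w Φ) {g : WeakDual ℝ V → ℝ} (hg : memCusc (stateSpace P v) g) :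
    IsCompact (polarBody P v Q Φ g) := by
  obtain ⟨x, hx⟩ := hV.cuscMajorants_nonempty hg
  exact (hW.isCompact_dualCone_inter_of_mem_openCone (hΦ.1.mapsTo hx.1) 1).of_isClosed_subset
    (isClosed_polarBody g) fun τ hτ => ⟨hτ.1, hτ.2 x hx⟩

theorem polarBody_mono {g k : WeakDual ℝ V → ℝ} (h : ∀ ρ ∈ stateSpace P v, g ρ ≤ k ρ) :
    polarBody P v Q Φ g ⊆ polarBody P v Q Φ k :=
  fun _ hτ => ⟨hτ.1, fun x hx => hτ.2 x ⟨hx.1, fun ρ hρ => (h ρ hρ).trans_lt (hx.2 ρ hρ)⟩⟩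

theorem exists_cuscMajorant_le_of_polarBody (hV : IsOrderUnitSpace V P v)
    (hW : IsOrderUnitSpace W Q w) (hΦ : GaugeReversing P v Q w Φ)
    (hne : (stateSpace P v).Nonempty) {g : WeakDual ℝ V → ℝ} (hg : memCusc (stateSpace P v) g)
    {x : V} (hx : x ∈ openCone P v) (hbd : ∀ τ ∈ polarBody P v Q Φ g, τ (Φ x) ≤ 1)
    {ε : ℝ} (hε : 0 < ε) : ∃ z ∈ cuscMajorants P v g, (1 + ε) • x - z ∈ P := by
  by_contra! hcon
  have hε1 : 0 < 1 + ε := by linarith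
  have hΦx := hΦ.1.mapsTo hx
  have hcpt : IsCompact {τ : WeakDual ℝ W | τ ∈ dualCone Q ∧ τ (Φ x) = 1} :=
    (hW.isCompact_dualCone_inter_of_mem_openCone hΦx 1).of_isClosed_subset
      (IsOrderUnitSpace.isClosed_dualCone.inter
        (isClosed_eq (WeakDual.eval_continuous (Φ x)) continuous_const))
      fun τ hτ => ⟨hτ.1, hτ.2.le⟩
  obtain ⟨τ, ⟨hτ, hτx⟩, hτz⟩ := exists_mem_forall_of_directed hcpt
    (hV.cuscMajorants_nonempty hg) (fun z τ => τ (Φ z))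
    (fun z _ => WeakDual.eval_continuous (Φ z)) (1 + ε)⁻¹
    (by
      intro x₁ h₁ x₂ h₂
      obtain ⟨x₃, h₃, h₁₃, h₂₃⟩ := hV.cuscMajorants_directed hg hne h₁ h₂
      refine ⟨x₃, h₃, fun τ hτ => ⟨?_, ?_⟩⟩
      · have := hτ.1 _ ((hΦ.2.2 _ h₃.1 _ h₁.1).1 h₁₃)
        rwa [map_sub, sub_nonneg] at this
      · have := hτ.1 _ ((hΦ.2.2 _ h₃.1 _ h₂.1).1 h₂₃)
        rwa [map_sub, sub_nonneg] at this)
    (by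
      intro z hz
      have hnot : Φ z - (1 + ε)⁻¹ • Φ x ∉ Q := by
        rw [← hΦ.2.1 x hx _ hε1]
        exact fun hmem => hcon z hz ((hΦ.2.2 _ hz.1 _ (hV.smul_mem_openCone hx hε1)).2 hmem)
      obtain ⟨τ, hτ, hlt⟩ : ∃ τ ∈ dualCone Q, τ (Φ z - (1 + ε)⁻¹ • Φ x) < 0 := by
        by_contra! hall
        exact hnot (hW.mem_of_forall_dualCone hall)
      have hτ0 : τ ≠ 0 := by
        rintro rfl
        exact lt_irrefl _ hlt
      have hpos := hW.apply_pos hΦx hτ hτ0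
      rw [map_sub, map_smul, smul_eq_mul, sub_neg] at hlt
      refine ⟨(τ (Φ x))⁻¹ • τ, ⟨fun y hy => mul_nonneg (inv_nonneg.2 hpos.le) (hτ y hy),
        inv_mul_cancel₀ hpos.ne'⟩, ?_⟩
      change (τ (Φ x))⁻¹ * τ (Φ z) ≤ _
      rw [inv_mul_le_iff₀ hpos, mul_comm (τ (Φ x))]
      exact hlt.le)
  have := hbd ((1 + ε) • τ) ⟨fun y hy => mul_nonneg hε1.le (hτ y hy), fun z hz => by
    change (1 + ε) * τ (Φ z) ≤ 1
    have := hτz z hz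
    rwa [← one_div, le_div_iff₀' hε1] at this⟩
  have : (1 + ε) * τ (Φ x) ≤ 1 := this
  rw [hτx] at this
  linarith

theorem le_of_polarBody_subset (hV : IsOrderUnitSpace V P v) (hW : IsOrderUnitSpace W Q w)
    (hΦ : GaugeReversing P v Q w Φ) {g k : WeakDual ℝ V → ℝ} (hg : memCusc (stateSpace P v) g)
    (hk : memCusc (stateSpace P v) k)
    (hsub : polarBody P v Q Φ g ⊆ polarBody P v Q Φ k) :
    ∀ ρ ∈ stateSpace P v, g ρ ≤ k ρ := by
  intro ρ hρ
  refine le_of_forall_gt_imp_ge_of_dense fun r hr => ?_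
  obtain ⟨x, hx, hxr⟩ := hV.exists_cuscMajorant_lt hk hρ hr
  have hρx := hV.apply_pos hx.1 hρ.1 (IsOrderUnitSpace.ne_zero_of_mem_stateSpace hρ)
  refine (le_of_forall_pos_le_add fun δ hδ => ?_ : g ρ ≤ ρ x).trans hxr.le
  obtain ⟨z, hz, hzx⟩ := exists_cuscMajorant_le_of_polarBody hV hW hΦ ⟨ρ, hρ⟩ hg hx.1
    (fun τ hτ => (hsub hτ).2 x hx) (div_pos hδ hρx)
  have h1 := hρ.1 _ hzx
  rw [map_sub, map_smul, smul_eq_mul, add_mul, one_mul, div_mul_cancel₀ _ hρx.ne'] at h1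
  linarith [hz.2 ρ hρ]

theorem isExtremeRay_of_mem_extremePoints (hV : IsOrderUnitSpace V P v)
    (hW : IsOrderUnitSpace W Q w) (hΦ : GaugeReversing P v Q w Φ)
    (hne : (stateSpace P v).Nonempty) {g : WeakDual ℝ V → ℝ} (hg : memCusc (stateSpace P v) g)
    {τ : WeakDual ℝ W} (hτ : τ ∈ (polarBody P v Q Φ g).extremePoints ℝ) (h0 : τ ≠ 0) :
    IsExtremeRay Q τ := by
  obtain ⟨hτg, hext⟩ := hτ
  refine ⟨hτg.1, h0, fun τ₁ h₁ h₂ => ?_⟩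
  rcases eq_or_ne τ₁ 0 with rfl | hne₁
  · exact ⟨0, le_rfl, zero_le_one, by simp⟩
  rcases eq_or_ne (τ - τ₁) 0 with he₂ | hne₂
  · exact ⟨1, zero_le_one, le_rfl, by rw [one_smul, sub_eq_zero.1 he₂]⟩
  have hsum : ∀ x ∈ cuscMajorants P v g, ∀ y ∈ cuscMajorants P v g,
      τ₁ (Φ x) + (τ - τ₁) (Φ y) ≤ 1 := by
    intro x hx y hy
    obtain ⟨z, hz, hzx, hzy⟩ := hV.cuscMajorants_directed hg hne hx hy
    have e₁ := h₁ _ ((hΦ.2.2 _ hz.1 _ hx.1).1 hzx)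
    have e₂ := h₂ _ ((hΦ.2.2 _ hz.1 _ hy.1).1 hzy)
    have e₃ := hτg.2 z hz
    have e₄ : (τ - τ₁) (Φ z) = τ (Φ z) - τ₁ (Φ z) := rfl
    rw [map_sub] at e₁ e₂
    linarith
  obtain ⟨x₀, hx₀⟩ := hV.cuscMajorants_nonempty hg
  have hpos : ∀ {τ' : WeakDual ℝ W}, τ' ∈ dualCone Q → τ' ≠ 0 → 0 < τ' (Φ x₀) :=
    fun h h' => hW.apply_pos (hΦ.1.mapsTo hx₀.1) h h'
  set S : Set ℝ := (fun x => τ₁ (Φ x)) '' cuscMajorants P v g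
  have hSne : S.Nonempty := ⟨_, x₀, hx₀, rfl⟩
  have hSbd : ∀ y ∈ cuscMajorants P v g, ∀ s ∈ S, s ≤ 1 - (τ - τ₁) (Φ y) := by
    rintro y hy _ ⟨x, hx, rfl⟩
    linarith [hsum x hx y hy]
  set a := sSup S
  have ha_le : ∀ y ∈ cuscMajorants P v g, a ≤ 1 - (τ - τ₁) (Φ y) := fun y hy =>
    csSup_le hSne (hSbd y hy)
  have le_a : ∀ x ∈ cuscMajorants P v g, τ₁ (Φ x) ≤ a := fun x hx =>
    le_csSup ⟨_, hSbd x₀ hx₀⟩ ⟨x, hx, rfl⟩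
  have ha0 : 0 < a := (hpos h₁ hne₁).trans_le (le_a x₀ hx₀)
  have ha1 : 0 < 1 - a := by linarith [ha_le x₀ hx₀, hpos h₂ hne₂]
  have hm₁ : a⁻¹ • τ₁ ∈ polarBody P v Q Φ g :=
    ⟨fun y hy => mul_nonneg (inv_nonneg.2 ha0.le) (h₁ y hy), fun x hx => by
      change a⁻¹ * τ₁ (Φ x) ≤ 1
      rw [inv_mul_le_iff₀ ha0, mul_one]
      exact le_a x hx⟩
  have hm₂ : (1 - a)⁻¹ • (τ - τ₁) ∈ polarBody P v Q Φ g :=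
    ⟨fun y hy => mul_nonneg (inv_nonneg.2 ha1.le) (h₂ y hy), fun x hx => by
      change (1 - a)⁻¹ * (τ - τ₁) (Φ x) ≤ 1
      rw [inv_mul_le_iff₀ ha1, mul_one]
      linarith [ha_le x hx]⟩
  have := hext hm₁ hm₂ ⟨a, 1 - a, ha0, ha1, by ring, by
    rw [smul_inv_smul₀ ha0.ne', smul_inv_smul₀ ha1.ne']
    abel⟩
  exact ⟨a, ha0.le, by linarith, by rw [← this, smul_inv_smul₀ ha0.ne']⟩

/-- The elements of the open cone whose `Φ`-image has `σ`-value less than `1`. -/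
def rayMajorants (P : Set V) (v : V) (Φ : V → W) (σ : WeakDual ℝ W) : Set V :=
  {x | x ∈ openCone P v ∧ σ (Φ x) < 1}

/-- The function on states corresponding under `Φ` to the functional `σ`. -/
noncomputable def rayAtom (P : Set V) (v : V) (Φ : V → W) (σ : WeakDual ℝ W)
    (ρ : WeakDual ℝ V) : ℝ :=
  sInf ((fun x => ρ x) '' rayMajorants P v Φ σ)

theorem smul_mem_rayMajorants (hV : IsOrderUnitSpace V P v) (hΦ : GaugeReversing P v Q w Φ)
    {σ : WeakDual ℝ W} {x : V} (hx : x ∈ openCone P v) {r : ℝ} (hr : 0 < r)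
    (hlt : σ (Φ x) < r) : r • x ∈ rayMajorants P v Φ σ := by
  refine ⟨hV.smul_mem_openCone hx hr, ?_⟩
  rwa [hΦ.2.1 x hx r hr, map_smul, smul_eq_mul, inv_mul_lt_iff₀ hr, mul_one]

theorem rayMajorants_nonempty (hV : IsOrderUnitSpace V P v) (hΦ : GaugeReversing P v Q w Φ)
    (σ : WeakDual ℝ W) : (rayMajorants P v Φ σ).Nonempty :=
  ⟨(|σ (Φ v)| + 1) • v, smul_mem_rayMajorants hV hΦ hV.unit_mem_openCone (by positivity)
    ((le_abs_self _).trans_lt (lt_add_one _))⟩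

theorem rayMajorants_directed (hW : IsOrderUnitSpace W Q w) (hΦ : GaugeReversing P v Q w Φ)
    {σ : WeakDual ℝ W} (hσ : IsExtremeRay Q σ) {x₁ x₂ : V} (h₁ : x₁ ∈ rayMajorants P v Φ σ)
    (h₂ : x₂ ∈ rayMajorants P v Φ σ) :
    ∃ x₃ ∈ rayMajorants P v Φ σ, x₁ - x₃ ∈ P ∧ x₂ - x₃ ∈ P := by
  obtain ⟨y, hy₁, hy₂, hy⟩ := hW.exists_upper_of_isExtremeRay hσ h₁.2 h₂.2
  have hyD : y ∈ openCone Q w := by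
    simpa using hW.add_mem_openCone (hΦ.1.mapsTo h₁.1) hy₁
  obtain ⟨x, hx, rfl⟩ := hΦ.1.surjOn hyD
  exact ⟨x, ⟨hx, hy⟩, (hΦ.2.2 _ hx _ h₁.1).2 hy₁, (hΦ.2.2 _ hx _ h₂.1).2 hy₂⟩

theorem bddBelow_rayMajorants (hV : IsOrderUnitSpace V P v) (σ : WeakDual ℝ W)
    {ρ : WeakDual ℝ V} (hρ : ρ ∈ stateSpace P v) :
    0 ∈ lowerBounds ((fun x => ρ x) '' rayMajorants P v Φ σ) := by
  rintro _ ⟨x, hx, rfl⟩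
  exact (hV.apply_pos hx.1 hρ.1 (IsOrderUnitSpace.ne_zero_of_mem_stateSpace hρ)).le

theorem rayAtom_le (hV : IsOrderUnitSpace V P v) {σ : WeakDual ℝ W} {ρ : WeakDual ℝ V}
    (hρ : ρ ∈ stateSpace P v) {x : V} (hx : x ∈ rayMajorants P v Φ σ) :
    rayAtom P v Φ σ ρ ≤ ρ x :=
  csInf_le ⟨0, bddBelow_rayMajorants hV σ hρ⟩ ⟨x, hx, rfl⟩

theorem exists_rayMajorant_lt (hV : IsOrderUnitSpace V P v) (hΦ : GaugeReversing P v Q w Φ)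
    {σ : WeakDual ℝ W} {ρ : WeakDual ℝ V} {r : ℝ} (hr : rayAtom P v Φ σ ρ < r) :
    ∃ x ∈ rayMajorants P v Φ σ, ρ x < r := by
  obtain ⟨_, ⟨x, hx, rfl⟩, h⟩ :=
    exists_lt_of_csInf_lt ((rayMajorants_nonempty hV hΦ σ).image _) hr
  exact ⟨x, hx, h⟩

theorem memCusc_rayAtom (hV : IsOrderUnitSpace V P v) (hW : IsOrderUnitSpace W Q w)
    (hΦ : GaugeReversing P v Q w Φ) {σ : WeakDual ℝ W} (hσ : IsExtremeRay Q σ) :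
    memCusc (stateSpace P v) (rayAtom P v Φ σ) := by
  refine ⟨fun ρ hρ => le_csInf ((rayMajorants_nonempty hV hΦ σ).image _)
    (bddBelow_rayMajorants hV σ hρ), fun ρ₁ h₁ ρ₂ h₂ t ht0 ht1 => le_antisymm ?_ ?_,
    fun ρ hρ c hc => ?_⟩
  · refine le_of_forall_pos_le_add fun ε hε => ?_
    obtain ⟨x₁, hx₁, hlt₁⟩ := exists_rayMajorant_lt hV hΦ
      (lt_add_of_pos_right (rayAtom P v Φ σ ρ₁) hε)
    obtain ⟨x₂, hx₂, hlt₂⟩ := exists_rayMajorant_lt hV hΦ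
      (lt_add_of_pos_right (rayAtom P v Φ σ ρ₂) hε)
    obtain ⟨x, hx, hxx₁, hxx₂⟩ := rayMajorants_directed hW hΦ hσ hx₁ hx₂
    have e₁ := h₁.1 _ hxx₁
    have e₂ := h₂.1 _ hxx₂
    rw [map_sub] at e₁ e₂
    refine (rayAtom_le hV (IsOrderUnitSpace.convex_stateSpace h₁ h₂ (sub_nonneg.2 ht1) ht0
      (sub_add_cancel 1 t)) hx).trans ?_
    change (1 - t) * ρ₁ x + t * ρ₂ x ≤ _
    have e₃ : (1 - t) * ρ₁ x ≤ (1 - t) * (rayAtom P v Φ σ ρ₁ + ε) :=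
      mul_le_mul_of_nonneg_left (by linarith) (sub_nonneg.2 ht1)
    have e₄ : t * ρ₂ x ≤ t * (rayAtom P v Φ σ ρ₂ + ε) :=
      mul_le_mul_of_nonneg_left (by linarith) ht0
    linarith
  · refine le_csInf ((rayMajorants_nonempty hV hΦ σ).image _) ?_
    rintro _ ⟨x, hx, rfl⟩
    exact add_le_add (mul_le_mul_of_nonneg_left (rayAtom_le hV h₁ hx) (sub_nonneg.2 ht1))
      (mul_le_mul_of_nonneg_left (rayAtom_le hV h₂ hx) ht0)
  · obtain ⟨x, hx, hlt⟩ := exists_rayMajorant_lt hV hΦ hc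
    filter_upwards [self_mem_nhdsWithin,
      nhdsWithin_le_nhds ((WeakDual.eval_continuous x).continuousAt.eventually_lt_const hlt)]
      with ρ' hρ' hlt'
    exact (rayAtom_le hV hρ' hx).trans_lt hlt'

theorem cuscMajorants_rayAtom (hV : IsOrderUnitSpace V P v) (hW : IsOrderUnitSpace W Q w)
    (hΦ : GaugeReversing P v Q w Φ) {σ : WeakDual ℝ W} (hσ : IsExtremeRay Q σ) :
    cuscMajorants P v (rayAtom P v Φ σ) = rayMajorants P v Φ σ := by
  refine Set.Subset.antisymm (fun x hx => ⟨hx.1, ?_⟩) fun x hx => ⟨hx.1, fun ρ hρ => ?_⟩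
  · by_contra! hge
    obtain ⟨ρ, hρ, hall⟩ := exists_mem_forall_of_directed hV.isCompact_stateSpace
      (rayMajorants_nonempty hV hΦ σ) (fun z ρ => ρ x - ρ z)
      (fun z _ => (WeakDual.eval_continuous x).sub (WeakDual.eval_continuous z)) 0
      (by
        intro x₁ h₁ x₂ h₂
        obtain ⟨x₃, h₃, h₁₃, h₂₃⟩ := rayMajorants_directed hW hΦ hσ h₁ h₂
        refine ⟨x₃, h₃, fun ρ hρ => ⟨?_, ?_⟩⟩
        · have := hρ.1 _ h₁₃
          rw [map_sub] at this
          linarith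
        · have := hρ.1 _ h₂₃
          rw [map_sub] at this
          linarith)
      (by
        intro z hz
        by_contra! hlt
        have hxz : x - z ∈ P := hV.mem_of_forall_stateSpace fun ρ hρ => by
          rw [map_sub]
          exact (hlt ρ hρ).le
        have := hσ.1 _ ((hΦ.2.2 _ hz.1 _ hx.1).1 hxz)
        rw [map_sub] at this
        linarith [hz.2])
    obtain ⟨z, hz, hlt⟩ := exists_rayMajorant_lt hV hΦ (hx.2 ρ hρ)
    linarith [hall z hz]
  · obtain ⟨r, hr, hr1⟩ := exists_between (max_lt one_half_lt_one hx.2)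
    rw [max_lt_iff] at hr
    have hr0 : 0 < r := by linarith [hr.1]
    have hρx := hV.apply_pos hx.1 hρ.1 (IsOrderUnitSpace.ne_zero_of_mem_stateSpace hρ)
    have := rayAtom_le hV hρ (smul_mem_rayMajorants hV hΦ hx.1 hr0 hr.2)
    rw [map_smul, smul_eq_mul] at this
    nlinarith

theorem polarBody_rayAtom (hV : IsOrderUnitSpace V P v) (hW : IsOrderUnitSpace W Q w)
    (hΦ : GaugeReversing P v Q w Φ) {σ : WeakDual ℝ W} (hσ : IsExtremeRay Q σ) :
    polarBody P v Q Φ (rayAtom P v Φ σ) = {τ | ∃ s : ℝ, 0 ≤ s ∧ s ≤ 1 ∧ τ = s • σ} := by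
  rw [polarBody, cuscMajorants_rayAtom hV hW hΦ hσ]
  refine Set.Subset.antisymm (fun τ hτ => hσ.2.2 τ hτ.1 ?_) ?_
  · have hle : ∀ y ∈ openCone Q w, τ y ≤ σ y := by
      intro y hy
      obtain ⟨x, hx, rfl⟩ := hΦ.1.surjOn hy
      have hσy := hW.apply_pos hy hσ.1 hσ.2.1
      refine le_of_forall_gt_imp_ge_of_dense fun r hr => ?_
      have hr0 := hσy.trans hr
      have := hτ.2 _ (smul_mem_rayMajorants hV hΦ hx hr0 hr)
      rwa [hΦ.2.1 x hx r hr0, map_smul, smul_eq_mul, inv_mul_le_iff₀ hr0, mul_one] at this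
    intro y hy
    change 0 ≤ σ y - τ y
    rw [sub_nonneg]
    refine le_of_forall_pos_le_add fun δ hδ => ?_
    have hσw := hW.apply_unit_pos hσ.1 hσ.2.1
    have hε : 0 < δ / σ w := div_pos hδ hσw
    have := hle _ (hW.add_mem_openCone (hW.smul_mem_openCone hW.unit_mem_openCone hε) hy)
    rw [map_add, map_add, map_smul, map_smul, smul_eq_mul, smul_eq_mul,
      div_mul_cancel₀ _ hσw.ne'] at this
    linarith [mul_nonneg hε.le (hτ.1 w hW.unit_mem)]
  · rintro _ ⟨s, hs0, hs1, rfl⟩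
    refine ⟨fun y hy => mul_nonneg hs0 (hσ.1 y hy), fun x hx => ?_⟩
    change s * σ (Φ x) ≤ 1
    have := hW.apply_pos (hΦ.1.mapsTo hx.1) hσ.1 hσ.2.1
    nlinarith [hx.2]

theorem memCusc.const_mul {K : Set (WeakDual ℝ V)} {g : WeakDual ℝ V → ℝ} (hg : memCusc K g)
    {t : ℝ} (ht : 0 ≤ t) : memCusc K fun ρ => t * g ρ := by
  refine ⟨fun ρ hρ => mul_nonneg ht (hg.1 ρ hρ), fun ρ hρ σ hσ s hs0 hs1 => ?_, ?_⟩
  · simp only [hg.2.1 ρ hρ σ hσ s hs0 hs1]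
    ring
  · rcases ht.eq_or_lt with rfl | ht
    · simpa using upperSemicontinuousOn_const
    · intro ρ hρ c hc
      have : g ρ < t⁻¹ * c := by rwa [lt_inv_mul_iff₀ ht]
      filter_upwards [hg.2.2 ρ hρ _ this] with ρ' h'
      rwa [lt_inv_mul_iff₀ ht] at h'

theorem isExtremalCusc_rayAtom (hV : IsOrderUnitSpace V P v) (hW : IsOrderUnitSpace W Q w)
    (hΦ : GaugeReversing P v Q w Φ) {σ : WeakDual ℝ W} (hσ : IsExtremeRay Q σ) :
    IsExtremalCusc (stateSpace P v) (rayAtom P v Φ σ) := by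
  have hp := memCusc_rayAtom hV hW hΦ hσ
  refine ⟨hp, ?_, fun q hq hqp => ?_⟩
  · by_contra! h0
    have hσv := hW.apply_pos (hΦ.1.mapsTo hV.unit_mem_openCone) hσ.1 hσ.2.1
    have hmem : (σ (Φ v)) • v ∈ cuscMajorants P v (rayAtom P v Φ σ) :=
      hV.mem_cuscMajorants hp fun ρ hρ => by
        rwa [h0 ρ hρ, map_smul, hρ.2, smul_eq_mul, mul_one]
    rw [cuscMajorants_rayAtom hV hW hΦ hσ] at hmem
    have := hmem.2
    rw [hΦ.2.1 v hV.unit_mem_openCone _ hσv, map_smul, smul_eq_mul, inv_mul_cancel₀ hσv.ne'] at this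
    exact lt_irrefl _ this
  · have hsub := polarBody_mono (Q := Q) (Φ := Φ) hqp
    rw [polarBody_rayAtom hV hW hΦ hσ] at hsub
    have hσw := hW.apply_unit_pos hσ.1 hσ.2.1
    obtain ⟨τ, hτ, hmax⟩ := (isCompact_polarBody hV hW hΦ hq).exists_isMaxOn
      ⟨0, zero_mem_polarBody q⟩ (WeakDual.eval_continuous w).continuousOn
    obtain ⟨t, ht0, ht1, rfl⟩ := hsub hτ
    have hle : ∀ s : ℝ, s • σ ∈ polarBody P v Q Φ q → s ≤ t := fun s hs =>
      le_of_mul_le_mul_right (show s * σ w ≤ t * σ w from hmax hs) hσw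
    have htp := hp.const_mul ht0
    refine ⟨t, ht0, ht1, fun ρ hρ => le_antisymm ?_ ?_⟩
    · refine le_of_polarBody_subset hV hW hΦ hq htp ?_ ρ hρ
      intro τ' hτ'
      obtain ⟨s, hs0, -, rfl⟩ := hsub hτ'
      refine ⟨hτ'.1, fun x hx => ?_⟩
      change s * σ (Φ x) ≤ 1
      have hσx := hW.apply_pos (hΦ.1.mapsTo hx.1) hσ.1 hσ.2.1
      refine (mul_le_mul_of_nonneg_right (hle s hτ') hσx.le).trans ?_
      rcases ht0.eq_or_lt with rfl | ht0
      · simp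
      · have hmem : t⁻¹ • x ∈ cuscMajorants P v (rayAtom P v Φ σ) :=
          ⟨hV.smul_mem_openCone hx.1 (inv_pos.2 ht0), fun ρ hρ => by
            rw [map_smul, smul_eq_mul, lt_inv_mul_iff₀ ht0]
            exact hx.2 ρ hρ⟩
        rw [cuscMajorants_rayAtom hV hW hΦ hσ] at hmem
        have := hmem.2
        rw [hΦ.2.1 x hx.1 _ (inv_pos.2 ht0), inv_inv, map_smul, smul_eq_mul] at this
        exact this.le
    · refine le_of_polarBody_subset hV hW hΦ htp hq ?_ ρ hρ
      rcases ht0.eq_or_lt with rfl | ht0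
      · exact polarBody_mono fun ρ hρ => by simpa using hq.1 ρ hρ
      · intro τ' hτ'
        have hmem : t⁻¹ • τ' ∈ polarBody P v Q Φ (rayAtom P v Φ σ) := by
          refine ⟨fun y hy => mul_nonneg (inv_nonneg.2 ht0.le) (hτ'.1 y hy), fun x hx => ?_⟩
          have := hτ'.2 (t • x) ⟨hV.smul_mem_openCone hx.1 ht0, fun ρ hρ => by
            rw [map_smul, smul_eq_mul]
            exact mul_lt_mul_of_pos_left (hx.2 ρ hρ) ht0⟩
          rwa [hΦ.2.1 x hx.1 t ht0, map_smul, smul_eq_mul] at this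
        rw [polarBody_rayAtom hV hW hΦ hσ] at hmem
        obtain ⟨s, hs0, hs1, hs⟩ := hmem
        have : τ' = s • t • σ := by
          rw [smul_comm, ← hs, smul_inv_smul₀ ht0.ne']
        rw [this]
        have := convex_polarBody q hτ (zero_mem_polarBody q) hs0 (sub_nonneg.2 hs1)
          (add_sub_cancel s 1)
        rwa [smul_zero, add_zero] at this

end GaugeReversing

/-- If there exists a gauge-reversing bijection between the open
cones of two complete order unit spaces `(V, P, v)` and `(W, Q, w)`, then the cone
`C_usc` of nonnegative affine upper semicontinuous functions on the state space of
`(V, P, v)` is strongly atomic. -/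
theorem stronglyAtomicCusc_of_gaugeReversing
    {V : Type*} [NormedAddCommGroup V] [NormedSpace ℝ V] [CompleteSpace V]
    {W : Type*} [NormedAddCommGroup W] [NormedSpace ℝ W] [CompleteSpace W]
    (P : Set V) (v : V) (Q : Set W) (w : W)
    (hV : IsOrderUnitSpace V P v) (hW : IsOrderUnitSpace W Q w)
    (Φ : V → W) (hΦ : GaugeReversing P v Q w Φ) :
    StronglyAtomicCusc (stateSpace P v) := by
  refine fun g hg => ⟨fun _ _ h => h, fun k hk hall ρ₀ hρ₀ => ?_⟩
  have hext : (polarBody P v Q Φ g).extremePoints ℝ ⊆ polarBody P v Q Φ k := by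
    intro σ hσ
    rcases eq_or_ne σ 0 with rfl | h0
    · exact zero_mem_polarBody k
    have hray := isExtremeRay_of_mem_extremePoints hV hW hΦ ⟨ρ₀, hρ₀⟩ hg hσ h0
    have hatom := polarBody_rayAtom hV hW hΦ hray
    have hp := isExtremalCusc_rayAtom hV hW hΦ hray
    have hpg := le_of_polarBody_subset hV hW hΦ hp.1 hg (by
      rw [hatom]
      rintro _ ⟨s, hs0, hs1, rfl⟩
      have := convex_polarBody g hσ.1 (zero_mem_polarBody g) hs0 (sub_nonneg.2 hs1)
        (add_sub_cancel s 1)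
      rwa [smul_zero, add_zero] at this)
    refine polarBody_mono (hall _ hp hpg) ?_
    rw [hatom]
    exact ⟨1, zero_le_one, le_rfl, (one_smul ℝ σ).symm⟩
  refine le_of_polarBody_subset hV hW hΦ hg hk ?_ ρ₀ hρ₀
  rw [← closure_convexHull_extremePoints (isCompact_polarBody hV hW hΦ hg) (convex_polarBody g)]
  exact closure_minimal (convexHull_min hext (convex_polarBody k)) (isClosed_polarBody k)
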